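/- For every t > 0, the 2π-periodic heat kernel Γ(z,t) = (1/√(4πt)) Σ_{k ∈ ℤ} e^{−(z + 2kπ)²/(4t)} is, as a function of z, strictly decreasing on the interval (0, π). -/

import Mathlib

open MeasureTheory Set Real

open Filter Topology

/-- The finite `q`-Pochhammer symbol `(Q; Q)_n`. -/
noncomputable def qPoch (Q : ℝ) (n : ℕ) : ℝ := ∏ i ∈ Finset.range n, (1 - Q ^ (i + 1))

/-- The reciprocal of `(Q; Q)_m`, extended by zero to negative `m`. -/
noncomputable def qPochInv (Q : ℝ) (m : ℤ) : ℝ := if 0 ≤ m then (qPoch Q m.toNat)⁻¹ else 0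

/-- The coefficient of `w ^ k` in the finite Jacobi triple product. -/
noncomputable def tripleCoeff (q : ℝ) (n : ℕ) (k : ℤ) : ℝ :=
  qPoch (q ^ 2) (2 * n) * (qPochInv (q ^ 2) (n - k) * qPochInv (q ^ 2) (n + k)) * q ^ (k ^ 2)

lemma qPoch_succ (Q : ℝ) (n : ℕ) : qPoch Q (n + 1) = qPoch Q n * (1 - Q ^ (n + 1)) :=
  Finset.prod_range_succ _ _

lemma qPoch_pos {Q : ℝ} (h0 : 0 < Q) (h1 : Q < 1) (n : ℕ) : 0 < qPoch Q n :=
  Finset.prod_pos fun i _ => sub_pos.2 (pow_lt_one₀ h0.le h1 i.succ_ne_zero)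

lemma qPoch_le_one {Q : ℝ} (h0 : 0 < Q) (h1 : Q < 1) (n : ℕ) : qPoch Q n ≤ 1 :=
  Finset.prod_le_one (fun i _ => (sub_pos.2 (pow_lt_one₀ h0.le h1 i.succ_ne_zero)).le)
    fun i _ => by linarith [pow_pos h0 (i + 1)]

lemma qPoch_antitone {Q : ℝ} (h0 : 0 < Q) (h1 : Q < 1) : Antitone (qPoch Q) :=
  antitone_nat_of_succ_le fun n => by
  rw [qPoch_succ]
  exact mul_le_of_le_one_right (qPoch_pos h0 h1 n).le (by linarith [pow_pos h0 (n + 1)])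

lemma exists_tendsto_qPoch {Q : ℝ} (h0 : 0 < Q) (h1 : Q < 1) :
    ∃ L, 0 < L ∧ Tendsto (qPoch Q) atTop (𝓝 L) := by
  have hs : Summable fun i : ℕ => -Q ^ (i + 1) :=
    (((summable_geometric_of_lt_one h0.le h1).mul_left Q).congr
      fun i => (pow_succ' Q i).symm).neg
  have hl := (Real.summable_log_one_add_of_summable hs).hasSum.tendsto_sum_nat
  refine ⟨_, Real.exp_pos _, ((Real.continuous_exp.tendsto _).comp hl).congr fun n => ?_⟩
  rw [Function.comp_apply, Real.exp_sum, qPoch]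
  refine Finset.prod_congr rfl fun i _ => ?_
  rw [← sub_eq_add_neg, Real.exp_log (sub_pos.2 (pow_lt_one₀ h0.le h1 i.succ_ne_zero))]

lemma qPochInv_sub_one {Q : ℝ} (h0 : 0 < Q) (h1 : Q < 1) (m : ℤ) :
    qPochInv Q (m - 1) = qPochInv Q m * (1 - Q ^ m) := by
  rcases lt_trichotomy m 0 with hm | rfl | hm
  · rw [qPochInv, qPochInv, if_neg (by lia), if_neg (by lia), zero_mul]
  · simp [qPochInv]
  · obtain ⟨n, rfl⟩ : ∃ n : ℕ, m = n + 1 := ⟨(m - 1).toNat, by lia⟩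
    have hp : 1 - Q ^ (n + 1) ≠ 0 := (sub_pos.2 (pow_lt_one₀ h0.le h1 n.succ_ne_zero)).ne'
    have hn := (qPoch_pos h0 h1 n).ne'
    rw [qPochInv, qPochInv, if_pos (by lia), if_pos (by lia), add_sub_cancel_right,
      Int.toNat_natCast, show ((n : ℤ) + 1).toNat = n + 1 by lia, qPoch_succ,
      show Q ^ ((n : ℤ) + 1) = Q ^ (n + 1) by exact_mod_cast zpow_natCast Q (n + 1)]
    field_simp

lemma qPochInv_nonneg {Q : ℝ} (h0 : 0 < Q) (h1 : Q < 1) (m : ℤ) : 0 ≤ qPochInv Q m := by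
  rw [qPochInv]
  split_ifs
  exacts [(inv_pos.2 (qPoch_pos h0 h1 _)).le, le_rfl]

lemma qPochInv_le {Q : ℝ} (h0 : 0 < Q) (h1 : Q < 1) {L : ℝ} (hL : 0 < L)
    (hlim : Tendsto (qPoch Q) atTop (𝓝 L)) (m : ℤ) :
    qPochInv Q m ≤ L⁻¹ := by
  rw [qPochInv]
  split_ifs
  exacts [inv_anti₀ hL ((qPoch_antitone h0 h1).le_of_tendsto hlim _), (inv_pos.2 hL).le]

lemma tendsto_qPochInv {Q L : ℝ} (hL : 0 < L) (hlim : Tendsto (qPoch Q) atTop (𝓝 L))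
    (k : ℤ) :
    Tendsto (fun n : ℕ => qPochInv Q (n + k)) atTop (𝓝 L⁻¹) := by
  have ht : Tendsto (fun n : ℕ => ((n : ℤ) + k).toNat) atTop atTop := by
    refine tendsto_atTop.2 fun b => ?_
    filter_upwards [eventually_ge_atTop (b + k.natAbs)] with n hn
    lia
  refine ((hlim.comp ht).inv₀ hL.ne').congr' ?_
  filter_upwards [eventually_ge_atTop k.natAbs] with n hn
  rw [qPochInv, if_pos (by lia), Function.comp_apply]

lemma tripleCoeff_succ {q : ℝ} (h0 : 0 < q) (h1 : q < 1) (n : ℕ) (k : ℤ) :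
    tripleCoeff q (n + 1) k = (1 + (q ^ (2 * n + 1)) ^ 2) * tripleCoeff q n k +
      q ^ (2 * n + 1) * (tripleCoeff q n (k - 1) + tripleCoeff q n (k + 1)) := by
  have hQ0 : 0 < q ^ 2 := by positivity
  have hQ1 : q ^ 2 < 1 := pow_lt_one₀ h0.le h1 two_ne_zero
  have hq := h0.ne'
  set A := qPochInv (q ^ 2) ((n : ℤ) + 1 - k) with hA
  set B := qPochInv (q ^ 2) ((n : ℤ) + 1 + k) with hB
  have hr := qPochInv_sub_one hQ0 hQ1
  have a1 : qPochInv (q ^ 2) (n - k) = A * (1 - (q ^ 2) ^ ((n : ℤ) + 1 - k)) := by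
    rw [← hr]; congr 1; ring
  have b1 : qPochInv (q ^ 2) (n + k) = B * (1 - (q ^ 2) ^ ((n : ℤ) + 1 + k)) := by
    rw [← hr]; congr 1; ring
  have a2 : qPochInv (q ^ 2) (n - (k + 1)) =
      A * (1 - (q ^ 2) ^ ((n : ℤ) + 1 - k)) * (1 - (q ^ 2) ^ ((n : ℤ) - k)) := by
    rw [← a1, ← hr]; congr 1; ring
  have b2 : qPochInv (q ^ 2) (n + (k - 1)) =
      B * (1 - (q ^ 2) ^ ((n : ℤ) + 1 + k)) * (1 - (q ^ 2) ^ ((n : ℤ) + k)) := by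
    rw [← b1, ← hr]; congr 1; ring
  have a3 : qPochInv (q ^ 2) (n - (k - 1)) = A := by rw [hA]; congr 1; ring
  have b3 : qPochInv (q ^ 2) (n + (k + 1)) = B := by rw [hB]; congr 1; ring
  have hP : qPoch (q ^ 2) (2 * (n + 1)) = qPoch (q ^ 2) (2 * n) * (1 - (q ^ 2) ^ (2 * n + 1)) *
      (1 - (q ^ 2) ^ (2 * n + 2)) := by
    rw [← qPoch_succ, ← qPoch_succ]; rfl
  have e1 : q ^ ((k - 1) ^ 2) = q ^ (k ^ 2) * q / (q ^ k) ^ 2 := by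
    rw [show (k - 1) ^ 2 = k ^ 2 + 1 - k * 2 by ring, zpow_sub₀ hq, zpow_add₀ hq, zpow_mul]; simp
  have e2 : q ^ ((k + 1) ^ 2) = q ^ (k ^ 2) * q * (q ^ k) ^ 2 := by
    rw [show (k + 1) ^ 2 = k ^ 2 + 1 + k * 2 by ring, zpow_add₀ hq, zpow_add₀ hq, zpow_mul]; simp
  have hk : (q ^ 2) ^ k = (q ^ k) ^ 2 := by
    rw [← zpow_natCast, ← zpow_mul, mul_comm, zpow_mul, zpow_natCast]
  have hY : q ^ k ≠ 0 := zpow_ne_zero _ hq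
  rw [tripleCoeff, tripleCoeff, tripleCoeff, tripleCoeff, a1, b1, a2, b2, a3, b3, hP, e1, e2]
  push_cast
  rw [← hA, ← hB]
  simp only [zpow_add₀ hQ0.ne', zpow_sub₀ hQ0.ne', hk, zpow_natCast, zpow_one]
  field_simp
  ring

lemma tripleCoeff_zero (q : ℝ) (k : ℤ) : tripleCoeff q 0 k = if k = 0 then 1 else 0 := by
  split_ifs with hk
  · simp [tripleCoeff, qPochInv, qPoch, hk]
  · rcases lt_or_gt_of_ne hk with h | h
    · simp [tripleCoeff, qPochInv, h.not_ge]
    · simp [tripleCoeff, qPochInv, h.not_ge]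

/-- The finite Jacobi triple product identity. -/
lemma hasSum_tripleCoeff {q : ℝ} (h0 : 0 < q) (h1 : q < 1) {w : ℂ} (hw : w ≠ 0) (n : ℕ) :
    HasSum (fun k : ℤ => (tripleCoeff q n k : ℂ) * w ^ k)
      (∏ j ∈ Finset.range n, (1 + (q ^ (2 * j + 1)) * (w + w⁻¹) + (q ^ (2 * j + 1)) ^ 2)) := by
  induction n with
  | zero =>
    rw [Finset.prod_range_zero]
    refine (hasSum_ite_eq (0 : ℤ) (1 : ℂ)).congr_fun fun k => ?_
    rw [tripleCoeff_zero]
    split_ifs with hk <;> simp [hk]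
  | succ n ih =>
    rw [Finset.prod_range_succ]
    set P := ∏ j ∈ Finset.range n,
      (1 + ((q : ℂ) ^ (2 * j + 1)) * (w + w⁻¹) + ((q : ℂ) ^ (2 * j + 1)) ^ 2)
    have hl := (Equiv.subRight (1 : ℤ)).hasSum_iff.2 (ih.mul_right w)
    have hr := (Equiv.addRight (1 : ℤ)).hasSum_iff.2 (ih.mul_right w⁻¹)
    rw [show P * (1 + (q : ℂ) ^ (2 * n + 1) * (w + w⁻¹) + ((q : ℂ) ^ (2 * n + 1)) ^ 2) =
      (1 + ((q : ℂ) ^ (2 * n + 1)) ^ 2) * P + (q : ℂ) ^ (2 * n + 1) * (P * w + P * w⁻¹) by ring]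
    refine ((ih.mul_left _).add ((hl.add hr).mul_left _)).congr_fun fun k => ?_
    rw [tripleCoeff_succ h0 h1]
    simp only [Function.comp_apply, Equiv.subRight_apply, Equiv.coe_addRight,
      zpow_sub₀ hw, zpow_add₀ hw, zpow_one]
    push_cast
    field_simp

lemma summable_zpow_sq {q : ℝ} (h0 : 0 < q) (h1 : q < 1) : Summable fun k : ℤ => q ^ (k ^ 2) := by
  have hT : 0 < -Real.log q / π := div_pos (neg_pos.2 (Real.log_neg h0 h1)) Real.pi_pos
  refine (summable_pow_mul_jacobiTheta₂_term_bound 0 hT 0).congr fun k => ?_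
  have : q ^ (k ^ 2) = Real.exp (Real.log q * (k : ℝ) ^ 2) := by
    rw [← Real.rpow_def_of_pos h0, ← Real.rpow_intCast]; push_cast; rfl
  rw [this, pow_zero, one_mul]
  congr 1
  field_simp
  ring

/-- The Jacobi triple product, up to a positive constant depending only on `q`. -/
lemma exists_tendsto_prod_theta {q : ℝ} (h0 : 0 < q) (h1 : q < 1) :
    ∃ C : ℝ, 0 < C ∧ ∀ w : ℂ, ‖w‖ = 1 →
    Tendsto (fun n => ∏ j ∈ Finset.range n,
        (1 + ((q : ℂ) ^ (2 * j + 1)) * (w + w⁻¹) + ((q : ℂ) ^ (2 * j + 1)) ^ 2)) atTop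
      (𝓝 (C * ∑' k : ℤ, (q : ℂ) ^ (k ^ 2) * w ^ k)) := by
  have hQ0 : 0 < q ^ 2 := by positivity
  have hQ1 : q ^ 2 < 1 := pow_lt_one₀ h0.le h1 two_ne_zero
  obtain ⟨L, hL, hlim⟩ := exists_tendsto_qPoch hQ0 hQ1
  refine ⟨L * (L⁻¹ * L⁻¹), by positivity, fun w hw => ?_⟩
  have hw0 : w ≠ 0 := by rintro rfl; simp at hw
  rw [← tsum_mul_left]
  refine Tendsto.congr (fun n => (hasSum_tripleCoeff h0 h1 hw0 n).tsum_eq) ?_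
  refine tendsto_tsum_of_dominated_convergence
    ((summable_zpow_sq h0 h1).mul_left (1 * (L⁻¹ * L⁻¹))) (fun k => ?_) (.of_forall fun n k => ?_)
  · have h2 : Tendsto (fun n : ℕ => 2 * n) atTop atTop :=
      tendsto_id.const_mul_atTop' two_pos
    have := ((hlim.comp h2).mul ((tendsto_qPochInv hL hlim (-k)).mul
      (tendsto_qPochInv hL hlim k))).mul_const (q ^ (k ^ 2))
    have := ((Complex.continuous_ofReal.tendsto _).comp this).mul_const (w ^ k)
    rw [← mul_assoc, show ((L * (L⁻¹ * L⁻¹) : ℝ) : ℂ) * (q : ℂ) ^ (k ^ 2) =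
      ((L * (L⁻¹ * L⁻¹) * q ^ (k ^ 2) : ℝ) : ℂ) by push_cast; rfl]
    exact this
  · rw [norm_mul, norm_zpow, hw, one_zpow, mul_one, Complex.norm_real, tripleCoeff, norm_mul,
      norm_mul, norm_mul, Real.norm_of_nonneg (qPoch_pos hQ0 hQ1 _).le,
      Real.norm_of_nonneg (qPochInv_nonneg hQ0 hQ1 _),
      Real.norm_of_nonneg (qPochInv_nonneg hQ0 hQ1 _), Real.norm_of_nonneg (zpow_pos h0 _).le]
    gcongr
    · exact mul_nonneg (qPochInv_nonneg hQ0 hQ1 _) (qPochInv_nonneg hQ0 hQ1 _)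
    · exact qPoch_le_one hQ0 hQ1 _
    · exact qPochInv_nonneg hQ0 hQ1 _
    · exact qPochInv_le hQ0 hQ1 hL hlim _
    · exact qPochInv_le hQ0 hQ1 hL hlim _

/-- Poisson summation for the periodic heat kernel. -/
lemma tsum_exp_zpow_eq (t : ℝ) (ht : 0 < t) (z : ℝ) :
    ∑' k : ℤ, ((Real.exp (-t) : ℝ) : ℂ) ^ (k ^ 2) * Complex.exp (-(z * Complex.I)) ^ k =
      ((1 / (t / π) ^ (1 / 2 : ℝ) *
        ∑' k : ℤ, Real.exp (-((z + 2 * k * π) ^ 2 / (4 * t))) : ℝ) : ℂ) := by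
  have hπ : (π : ℂ) ≠ 0 := by exact_mod_cast Real.pi_ne_zero
  have htc : (t : ℂ) ≠ 0 := by exact_mod_cast ht.ne'
  have ha : 0 < ((t / π : ℝ) : ℂ).re := by rw [Complex.ofReal_re]; positivity
  have h := Complex.tsum_exp_neg_quadratic ha (-(z * Complex.I) / (2 * π))
  have hI : Complex.I * (-(z * Complex.I) / (2 * π)) = z / (2 * π) := by
    linear_combination (-(z : ℂ) / (2 * π)) * Complex.I_mul_I
  rw [hI] at h
  convert h using 1
  · refine tsum_congr fun k => ?_
    rw [Complex.ofReal_exp, ← Complex.exp_int_mul, ← Complex.exp_int_mul, ← Complex.exp_add]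
    congr 1
    push_cast
    field_simp
  · rw [Complex.ofReal_mul, Complex.ofReal_tsum, Complex.ofReal_div, Complex.ofReal_cpow
      (by positivity)]
    congr 1
    · push_cast; rfl
    · refine tsum_congr fun k => ?_
      rw [Complex.ofReal_exp]
      congr 1
      push_cast
      field_simp
      ring

lemma summable_periodic_gaussian (t : ℝ) (ht : 0 < t) (z : ℝ) :
    Summable fun k : ℤ => Real.exp (-((z + 2 * k * π) ^ 2 / (4 * t))) := by
  have hT : 0 < π / t := by positivity
  have h := (summable_pow_mul_jacobiTheta₂_term_bound (|z| / (2 * t)) hT 0).mul_left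
    (Real.exp (-(z ^ 2 / (4 * t))))
  refine h.of_nonneg_of_le (fun k => (Real.exp_pos _).le) fun k => ?_
  rw [pow_zero, one_mul, ← Real.exp_add, Real.exp_le_exp]
  have hzk : -(z * k) ≤ |z| * |(k : ℝ)| := by rw [← abs_mul]; exact neg_le_abs _
  have : 0 ≤ π / t * (|z| * |(k : ℝ)| + z * k) := mul_nonneg hT.le (by linarith)
  have e : -(z ^ 2 / (4 * t)) + -π * (π / t * k ^ 2 - 2 * (|z| / (2 * t)) * |(k : ℝ)|) -
      -((z + 2 * k * π) ^ 2 / (4 * t)) = π / t * (|z| * |(k : ℝ)| + z * k) := by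
    field_simp
    ring
  push_cast
  linarith

lemma exists_tendsto_prod_periodic_gaussian (t : ℝ) (ht : 0 < t) : ∃ C : ℝ, 0 < C ∧ ∀ z : ℝ,
    Tendsto (fun n => ∏ j ∈ Finset.range n,
        (1 + Real.exp (-t) ^ (2 * j + 1) * (2 * Real.cos z) + (Real.exp (-t) ^ (2 * j + 1)) ^ 2))
      atTop (𝓝 (C * ∑' k : ℤ, Real.exp (-((z + 2 * k * π) ^ 2 / (4 * t))))) := by
  obtain ⟨C, hC, h⟩ := exists_tendsto_prod_theta (Real.exp_pos (-t))
    (Real.exp_lt_one_iff.2 (neg_lt_zero.2 ht))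
  refine ⟨C * (1 / (t / π) ^ (1 / 2 : ℝ)), by positivity, fun z => ?_⟩
  have hw := h (Complex.exp (-(z * Complex.I))) (by
    rw [← neg_mul, ← Complex.ofReal_neg, Complex.norm_exp_ofReal_mul_I])
  rw [tsum_exp_zpow_eq t ht, ← Complex.exp_neg, neg_neg, add_comm (Complex.exp _),
    ← neg_mul, ← Complex.two_cos] at hw
  rw [mul_assoc]
  refine ((Complex.continuous_re.tendsto _).comp hw).congr' ?_ |>.trans_eq ?_
  · refine .of_forall fun n => ?_
    rw [Function.comp_apply]
    exact_mod_cast Complex.ofReal_re (∏ j ∈ Finset.range n,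
      (1 + Real.exp (-t) ^ (2 * j + 1) * (2 * Real.cos z) + (Real.exp (-t) ^ (2 * j + 1)) ^ (2 : ℕ)))
  · rw [← Complex.ofReal_mul, Complex.ofReal_re]

theorem stmt_6 (t : ℝ) (ht : 0 < t) :
    StrictAntiOn
      (fun z : ℝ => (1 / Real.sqrt (4 * π * t)) *
        ∑' k : ℤ, Real.exp (-((z + 2 * k * π) ^ 2 / (4 * t))))
      (Set.Ioo 0 π) := by
  obtain ⟨C, hC, hlim⟩ := exists_tendsto_prod_periodic_gaussian t ht
  intro x hx y hy hxy
  refine mul_lt_mul_of_pos_left ?_ (by positivity)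
  have hcos : Real.cos y < Real.cos x :=
    Real.strictAntiOn_cos (Ioo_subset_Icc_self hx) (Ioo_subset_Icc_self hy) hxy
  set q := Real.exp (-t)
  have hq0 : 0 < q := Real.exp_pos _
  have hq1 : q < 1 := Real.exp_lt_one_iff.2 (neg_lt_zero.2 ht)
  set G : ℝ → ℝ := fun z => ∑' k : ℤ, Real.exp (-((z + 2 * k * π) ^ 2 / (4 * t)))
  have hGy : 0 < G y :=
    (summable_periodic_gaussian t ht y).tsum_pos (fun k => (Real.exp_pos _).le) 0 (Real.exp_pos _)
  set F : ℕ → ℝ → ℝ := fun j z =>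
    1 + q ^ (2 * j + 1) * (2 * Real.cos z) + (q ^ (2 * j + 1)) ^ 2 with hF
  have hFpos (j : ℕ) (z : ℝ) : 0 < F j z := by
    have hr0 : 0 < q ^ (2 * j + 1) := by positivity
    have hr1 : q ^ (2 * j + 1) < 1 := pow_lt_one₀ hq0.le hq1 (by lia)
    simp only [hF]
    nlinarith [Real.neg_one_le_cos z]
  have hFlt (j : ℕ) : F j y < F j x := by
    simp only [hF]
    gcongr
  have hle : F 0 x * (C * G y) ≤ F 0 y * (C * G x) := by
    refine le_of_tendsto_of_tendsto' (((tendsto_add_atTop_iff_nat 1).2 (hlim y)).const_mul (F 0 x))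
      (((tendsto_add_atTop_iff_nat 1).2 (hlim x)).const_mul (F 0 y)) fun n => ?_
    change F 0 x * ∏ j ∈ Finset.range (n + 1), F j y ≤ F 0 y * ∏ j ∈ Finset.range (n + 1), F j x
    rw [Finset.prod_range_succ', Finset.prod_range_succ', mul_left_comm, mul_left_comm (F 0 y),
      mul_comm (F 0 x)]
    exact mul_le_mul_of_nonneg_right
      (Finset.prod_le_prod (fun j _ => (hFpos _ _).le) fun j _ => (hFlt _).le)
      (mul_pos (hFpos _ _) (hFpos _ _)).le
  have hlt : F 0 y * (C * G y) < F 0 x * (C * G y) :=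
    mul_lt_mul_of_pos_right (hFlt 0) (mul_pos hC hGy)
  exact lt_of_mul_lt_mul_left (lt_of_mul_lt_mul_left (hlt.trans_le hle) (hFpos 0 y).le) hC.le
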